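/- Let P = {I, J, K} be a partition of {1,…,n} into three sets. Suppose C = ABᵀ + D = A'B'ᵀ + D', where A, B, A', B' ∈ ℝ^{n×k}, D and D' are diagonal n×n matrices, and all eight row-submatrices A_I, A_J, A_K, B_I, B_J, B_K, A'_I, A'_J, A'_K, B'_I, B'_J, B'_K indexed by the parts of P have full column rank k. Then ABᵀ = A'B'ᵀ and D = D'; that is, the decomposition of C into a low-rank part of this form and a diagonal part is unique. -/

import Mathlib

open Matrix

/-- A matrix (with finitely many rows) has full column rank if its columns are
linearly independent. -/
def FullColRank {m : Type*} [Fintype m] {k : ℕ} (M : Matrix m (Fin k) ℝ) : Prop :=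
  LinearIndependent ℝ (fun j : Fin k => fun i : m => M i j)

/-- Row-submatrix of `M` indexed by a finset `I` of rows. -/
def rowSub {n k : ℕ} (M : Matrix (Fin n) (Fin k) ℝ) (I : Finset (Fin n)) :
    Matrix {i // i ∈ I} (Fin k) ℝ :=
  M.submatrix (fun x : {i // i ∈ I} => (x : Fin n)) id

theorem FullColRank.exists_left_inverse {m : Type*} [Fintype m] {k : ℕ}
    {M : Matrix m (Fin k) ℝ} (hM : FullColRank M) :
    ∃ N : Matrix (Fin k) m ℝ, N * M = 1 := by
  classical
  have hinj : Function.Injective M.mulVec := Matrix.mulVec_injective_iff.mpr hM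
  obtain ⟨g, hg⟩ := LinearMap.exists_leftInverse_of_injective M.toLin'
    (LinearMap.ker_eq_bot.mpr hinj)
  refine ⟨LinearMap.toMatrix' g, ?_⟩
  have h := congrArg LinearMap.toMatrix' hg
  rwa [LinearMap.toMatrix'_comp, LinearMap.toMatrix'_toLin', LinearMap.toMatrix'_id] at h

theorem FullColRank.mul_left_cancel {m l : Type*} [Fintype m] {k : ℕ}
    {M : Matrix m (Fin k) ℝ} (hM : FullColRank M) {X Y : Matrix (Fin k) l ℝ}
    (h : M * X = M * Y) : X = Y := by
  obtain ⟨N, hN⟩ := hM.exists_left_inverse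
  simpa [← Matrix.mul_assoc, hN] using congrArg (N * ·) h

/-- Two full-rank factorizations of a block differ by a change of basis, which also relates the
right factors of any further block in the same rows. -/
theorem exists_change_of_basis {p q r : Type*} [Fintype p] [Fintype q] {k : ℕ}
    {A A' : Matrix p (Fin k) ℝ} {B B' : Matrix q (Fin k) ℝ} {E E' : Matrix r (Fin k) ℝ}
    (hA : FullColRank A) (hB' : FullColRank B')
    (hB : A * Bᵀ = A' * B'ᵀ) (hE : A * Eᵀ = A' * E'ᵀ) :
    ∃ Y : Matrix (Fin k) (Fin k) ℝ, A' = A * Yᵀ ∧ B = B' * Y ∧ E = E' * Y := by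
  obtain ⟨N, hN⟩ := hB'.exists_left_inverse
  have hNt : B'ᵀ * Nᵀ = 1 := by rw [← Matrix.transpose_mul, hN, Matrix.transpose_one]
  have hA' : A' = A * (N * B)ᵀ := by
    rw [Matrix.transpose_mul, ← Matrix.mul_assoc, hB, Matrix.mul_assoc, hNt, Matrix.mul_one]
  refine ⟨N * B, hA', ?_, ?_⟩
  · apply Matrix.transpose_injective
    apply hA.mul_left_cancel
    rw [Matrix.transpose_mul, ← Matrix.mul_assoc, ← hA', hB]
  · apply Matrix.transpose_injective
    apply hA.mul_left_cancel
    rw [Matrix.transpose_mul, ← Matrix.mul_assoc, ← hA', hE]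

theorem rowSub_mul_transpose_eq_of_disjoint {n k : ℕ}
    {A B A' B' : Matrix (Fin n) (Fin k) ℝ} {D D' : Matrix (Fin n) (Fin n) ℝ}
    (hD : D.IsDiag) (hD' : D'.IsDiag) (heq : A * Bᵀ + D = A' * B'ᵀ + D')
    {S T : Finset (Fin n)} (hST : Disjoint S T) :
    rowSub A S * (rowSub B T)ᵀ = rowSub A' S * (rowSub B' T)ᵀ := by
  ext ⟨i, hi⟩ ⟨j, hj⟩
  have hij : i ≠ j := fun h => Finset.disjoint_left.mp hST hi (h ▸ hj)
  have h := congrFun₂ heq i j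
  rw [Matrix.add_apply, Matrix.add_apply, hD hij, hD' hij, add_zero, add_zero] at h
  exact h

theorem eq_mul_of_rowSub_eq_mul {n k : ℕ} {M M' : Matrix (Fin n) (Fin k) ℝ}
    {Y : Matrix (Fin k) (Fin k) ℝ} {I J K : Finset (Fin n)}
    (hcover : I ∪ J ∪ K = Finset.univ) (hI : rowSub M I = rowSub M' I * Y)
    (hJ : rowSub M J = rowSub M' J * Y) (hK : rowSub M K = rowSub M' K * Y) :
    M = M' * Y := by
  ext i j
  have hi : i ∈ I ∪ J ∪ K := hcover ▸ Finset.mem_univ i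
  rw [Finset.mem_union, Finset.mem_union] at hi
  rcases hi with (hi | hi) | hi
  · exact congrFun₂ hI ⟨i, hi⟩ j
  · exact congrFun₂ hJ ⟨i, hi⟩ j
  · exact congrFun₂ hK ⟨i, hi⟩ j

/-- let `{I, J, K}` be a partition of `{1,…,n}` into three sets
and suppose `ABᵀ + D = A'B'ᵀ + D'` with `D, D'` diagonal, where all the
row-submatrices of `A, B, A', B'` indexed by the parts have full column rank.
Then `ABᵀ = A'B'ᵀ` and `D = D'`: the decomposition into a low-rank part of
this form and a diagonal part is unique. -/
theorem low_rank_plus_diagonal_unique {n k : ℕ}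
    (A B A' B' : Matrix (Fin n) (Fin k) ℝ)
    (D D' : Matrix (Fin n) (Fin n) ℝ)
    (I J K : Finset (Fin n))
    (hIJ : Disjoint I J) (hIK : Disjoint I K) (hJK : Disjoint J K)
    (hcover : I ∪ J ∪ K = Finset.univ)
    (hD : D.IsDiag) (hD' : D'.IsDiag)
    (hA : FullColRank (rowSub A I) ∧ FullColRank (rowSub A J) ∧
      FullColRank (rowSub A K))
    (hB : FullColRank (rowSub B I) ∧ FullColRank (rowSub B J) ∧
      FullColRank (rowSub B K))
    (hA' : FullColRank (rowSub A' I) ∧ FullColRank (rowSub A' J) ∧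
      FullColRank (rowSub A' K))
    (hB' : FullColRank (rowSub B' I) ∧ FullColRank (rowSub B' J) ∧
      FullColRank (rowSub B' K))
    (heq : A * B.transpose + D = A' * B'.transpose + D') :
    A * B.transpose = A' * B'.transpose ∧ D = D' := by
  have block {S T : Finset (Fin n)} (hST : Disjoint S T) :=
    rowSub_mul_transpose_eq_of_disjoint hD hD' heq hST
  obtain ⟨Y, hAI, hBJ, hBK⟩ :=
    exists_change_of_basis hA.1 hB'.2.1 (block hIJ) (block hIK)
  obtain ⟨Y₂, hAJ, hBI, hBK₂⟩ :=
    exists_change_of_basis hA.2.1 hB'.1 (block hIJ.symm) (block hJK)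
  obtain ⟨Y₃, hAK, -, hBJ₃⟩ :=
    exists_change_of_basis hA.2.2 hB'.1 (block hIK.symm) (block hJK.symm)
  obtain rfl : Y = Y₂ := hB'.2.2.mul_left_cancel (hBK.symm.trans hBK₂)
  obtain rfl : Y = Y₃ := hB'.2.1.mul_left_cancel (hBJ.symm.trans hBJ₃)
  have hAA' : A' = A * Yᵀ := eq_mul_of_rowSub_eq_mul hcover hAI hAJ hAK
  have hBB' : B = B' * Y := eq_mul_of_rowSub_eq_mul hcover hBI hBJ hBK
  have hlow : A * Bᵀ = A' * B'ᵀ := by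
    rw [hAA', hBB', Matrix.transpose_mul, Matrix.mul_assoc]
  exact ⟨hlow, add_left_cancel (hlow ▸ heq)⟩
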